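/- arXiv:0802.0850 — 5 statements merged into one kernel-verified Lean document; each statement's English description precedes it below -/
import Mathlib

section
/- Let n ≥ 1 and let f : B_1 ⊂ ℝ^n → [0,∞) be integrable, extended by 0 outside B_1. Then there is a constant C depending only on n such that for every b > 0, L^{2n}( { (x,y) ∈ B_1 × B_1 : ∫_{[x,y]} f dH^1 > b } ) ≤ (C/b) ∫_{B_1} f dx. -/
open MeasureTheory Metric Set Matrix
open scoped ENNReal NNReal RealInnerProductSpace

attribute [local instance] Matrix.frobeniusNormedAddCommGroup

noncomputable section

/-- The space of real `n × n` matrices. -/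
abbrev Mat (n : ℕ) : Type := Matrix (Fin n) (Fin n) ℝ

/-- Euclidean `n`-space. -/
abbrev Euc (n : ℕ) : Type := EuclideanSpace ℝ (Fin n)

/-- The special orthogonal group `SO(n)`, as a set of matrices. -/
def SOn (n : ℕ) : Set (Mat n) := {Q | Qᵀ * Q = 1 ∧ Q.det = 1}

/-- The well `SO(n)A = {QA : Q ∈ SO(n)}`. -/
def well {n : ℕ} (A : Mat n) : Set (Mat n) := (fun Q => Q * A) '' SOn n

/-- Distance (in the Frobenius norm) from a matrix to a set of matrices. -/
def matDist {n : ℕ} (M : Mat n) (L : Set (Mat n)) : ℝ := Metric.infDist M L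

/-- Euclidean norm of a vector of `ℝ^n`. -/
def vnorm {n : ℕ} (v : Fin n → ℝ) : ℝ := Real.sqrt (∑ i, v i ^ 2)

/-- Identification of a plain vector with a point of Euclidean space. -/
def toEuc {n : ℕ} (v : Fin n → ℝ) : Euc n := WithLp.toLp 2 v

/-- Identification of a point of Euclidean space with a plain vector. -/
def ofEuc {n : ℕ} (x : Euc n) : Fin n → ℝ := x

/-- The Jacobian matrix `Du(x)` of a map `u : ℝ^n → ℝ^n`. -/
def Jac {n : ℕ} (u : Euc n → Euc n) (x : Euc n) : Mat n :=
  Matrix.of fun i j => fderiv ℝ u x (EuclideanSpace.single j 1) i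

/-- The norm `|D²u(x)|` of the second derivative of `u`. -/
def D2 {n : ℕ} (u : Euc n → Euc n) (x : Euc n) : ℝ := ‖iteratedFDeriv ℝ 2 u x‖


theorem aux_seg {n : ℕ} (g : Euc n → ℝ≥0∞) (hg : Measurable g) (x y : Euc n) :
    ∫⁻ p in segment ℝ x y, g p ∂μH[1] ≤
      ENNReal.ofReal (dist x y) * ∫⁻ t in Icc (0:ℝ) 1, g ((1 - t) • x + t • y) := by
  have hm : Measurable (fun t : ℝ => (1 - t) • x + t • y) := by fun_prop
  have hL : ∀ t : ℝ, AffineMap.lineMap x y t = (1 - t) • x + t • y :=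
    fun t => AffineMap.lineMap_apply_module x y t
  have key : (μH[1] : Measure (Euc n)).restrict (segment ℝ x y) ≤
      ENNReal.ofReal (dist x y) •
        (volume.restrict (Icc (0:ℝ) 1)).map (fun t : ℝ => (1 - t) • x + t • y) := by
    refine Measure.le_iff.2 fun A hA => ?_
    rw [Measure.restrict_apply hA, Measure.smul_apply, Measure.map_apply hm hA,
      Measure.restrict_apply (hm hA)]
    have hsub : A ∩ segment ℝ x y ⊆ AffineMap.lineMap x y ''
        ((fun t : ℝ => (1 - t) • x + t • y) ⁻¹' A ∩ Icc (0:ℝ) 1) := by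
      rintro p ⟨hpA, hp⟩
      rw [segment_eq_image] at hp
      obtain ⟨t, ht, rfl⟩ := hp
      exact ⟨t, ⟨hpA, ht⟩, hL t⟩
    refine (measure_mono hsub).trans ?_
    rw [hausdorffMeasure_lineMap_image, hausdorffMeasure_real]
    apply le_of_eq
    rw [ENNReal.smul_def, smul_eq_mul, smul_eq_mul, ← edist_dist, edist_nndist]
  calc _ ≤ ∫⁻ p, g p ∂(ENNReal.ofReal (dist x y) •
        (volume.restrict (Icc (0:ℝ) 1)).map (fun t : ℝ => (1 - t) • x + t • y)) :=
        lintegral_mono' key le_rfl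
    _ = _ := by rw [lintegral_smul_measure, lintegral_map hg hm, smul_eq_mul]

theorem aux_cov {n : ℕ} (g : Euc n → ℝ≥0∞) (hg : Measurable g) (r : ℝ) (hr : 1 / 2 ≤ r)
    (v : Euc n) : ∫⁻ x, g (r • x + v) ≤ 2 ^ n * ∫⁻ x, g x := by
  have hr0 : 0 < r := by linarith
  have h1 : ∫⁻ x, g (r • x + v) = ∫⁻ x, g (x + v) ∂(volume.map (fun x : Euc n => r • x)) := by
    rw [lintegral_map (by fun_prop) (by fun_prop)]
  have h2 : (volume.map (fun x : Euc n => r • x)) =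
      ENNReal.ofReal |(r ^ Module.finrank ℝ (Euc n))⁻¹| • volume :=
    Measure.map_addHaar_smul volume hr0.ne'
  rw [h1, h2, lintegral_smul_measure, lintegral_add_right_eq_self g v, smul_eq_mul]
  gcongr
  rw [finrank_euclideanSpace_fin, abs_of_nonneg (by positivity), ← inv_pow]
  have : r⁻¹ ≤ 2 := by
    rw [inv_le_comm₀ hr0 (by norm_num)]; linarith
  calc ENNReal.ofReal (r⁻¹ ^ n) ≤ ENNReal.ofReal (2 ^ n) :=
        ENNReal.ofReal_le_ofReal (by gcongr)
    _ = 2 ^ n := by rw [ENNReal.ofReal_pow (by norm_num)]; simp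

theorem aux_t {n : ℕ} (g : Euc n → ℝ≥0∞) (hg : Measurable g) (t : ℝ) :
    ∫⁻ z in (ball (0 : Euc n) 1 ×ˢ ball (0 : Euc n) 1), g ((1 - t) • z.1 + t • z.2) ≤
      volume (ball (0 : Euc n) 1) * (2 ^ n * ∫⁻ x, g x) := by
  have hm : Measurable (fun z : Euc n × Euc n => g ((1 - t) • z.1 + t • z.2)) := by fun_prop
  rw [Measure.volume_eq_prod, ← Measure.prod_restrict]
  rcases le_total t (1/2) with ht | ht
  · rw [lintegral_prod_symm _ hm.aemeasurable]
    calc _ ≤ ∫⁻ y in ball (0 : Euc n) 1, (2 ^ n * ∫⁻ x, g x) := by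
          refine lintegral_mono fun y => ?_
          exact (setLIntegral_le_lintegral _ _).trans (aux_cov g hg (1 - t) (by linarith) (t • y))
      _ = _ := by rw [setLIntegral_const, mul_comm]
  · rw [lintegral_prod _ hm.aemeasurable]
    calc _ ≤ ∫⁻ y in ball (0 : Euc n) 1, (2 ^ n * ∫⁻ x, g x) := by
          refine lintegral_mono fun x => ?_
          refine (setLIntegral_le_lintegral _ _).trans ?_
          have := aux_cov g hg t ht ((1 - t) • x)
          simpa only [add_comm] using this
      _ = _ := by rw [setLIntegral_const, mul_comm]

theorem aux_total {n : ℕ} (g : Euc n → ℝ≥0∞) (hg : Measurable g) :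
    ∫⁻ z in (ball (0 : Euc n) 1 ×ˢ ball (0 : Euc n) 1),
        2 * ∫⁻ t in Icc (0:ℝ) 1, g ((1 - t) • z.1 + t • z.2) ≤
      2 * (volume (ball (0 : Euc n) 1) * (2 ^ n * ∫⁻ x, g x)) := by
  have hm : Measurable (fun p : (Euc n × Euc n) × ℝ =>
      g ((1 - p.2) • p.1.1 + p.2 • p.1.2)) := by fun_prop
  rw [lintegral_const_mul' _ _ (by norm_num), lintegral_lintegral_swap hm.aemeasurable]
  gcongr
  calc _ ≤ ∫⁻ t in Icc (0:ℝ) 1, volume (ball (0 : Euc n) 1) * (2 ^ n * ∫⁻ x, g x) :=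
        lintegral_mono fun t => aux_t g hg t
    _ = _ := by rw [setLIntegral_const]; simp

theorem aux_major {n : ℕ} (f : Euc n → ℝ) (hf : AEMeasurable f) :
    ∃ g : Euc n → ℝ≥0∞, Measurable g ∧ (∀ x, ENNReal.ofReal (f x) ≤ g x) ∧
      ∫⁻ x, g x = ∫⁻ x, ENNReal.ofReal (f x) := by
  classical
  obtain ⟨f', hf', hae⟩ := hf
  set N := toMeasurable volume {x | ¬ f x = f' x} with hN
  have hN0 : volume N = 0 := by rw [hN, measure_toMeasurable]; exact hae
  have hNm : MeasurableSet N := measurableSet_toMeasurable _ _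
  refine ⟨N.piecewise (fun _ => ∞) (fun x => ENNReal.ofReal (f' x)),
    Measurable.piecewise hNm measurable_const hf'.ennreal_ofReal, fun x => ?_, ?_⟩
  · by_cases hx : x ∈ N
    · simp [hx]
    · have : f x = f' x := by
        by_contra h
        exact hx (subset_toMeasurable _ _ h)
      simp [hx, this]
  · refine lintegral_congr_ae ?_
    have h1 : ∀ᵐ x, x ∉ N := measure_eq_zero_iff_ae_notMem.1 hN0
    filter_upwards [h1, hae] with x hx hx'
    simp [hx, hx']

/-- **Measure of pairs of points whose segment carries a large integral** (Lemma `L.goodpairs`). -/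
theorem measure_pairs_large_segment_integral
    (n : ℕ) (hn : 1 ≤ n) :
    ∃ C : ℝ, 0 < C ∧
      ∀ f : Euc n → ℝ, (∀ x, 0 ≤ f x) → (∀ x ∉ ball (0 : Euc n) 1, f x = 0) →
        IntegrableOn f (ball (0 : Euc n) 1) →
        ∀ b : ℝ, 0 < b →
          volume {z : Euc n × Euc n | z.1 ∈ ball (0 : Euc n) 1 ∧ z.2 ∈ ball (0 : Euc n) 1 ∧
              b < ∫ y in segment ℝ z.1 z.2, f y ∂μH[1]}
            ≤ ENNReal.ofReal ((C / b) * ∫ x in ball (0 : Euc n) 1, f x) := by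
  set V := volume (ball (0 : Euc n) 1) with hV
  have hVt : V ≠ ∞ := measure_ball_lt_top.ne
  have hV0 : V ≠ 0 := (measure_ball_pos _ _ one_pos).ne'
  have hVr : 0 < V.toReal := ENNReal.toReal_pos hV0 hVt
  refine ⟨2 * (V.toReal * 2 ^ n), by positivity, ?_⟩
  intro f hf0 hfout hfi b hb
  have hfint : Integrable f := by
    refine (integrableOn_iff_integrable_of_support_subset fun x hx => ?_).1 hfi
    by_contra h
    exact hx (hfout x h)
  obtain ⟨g, hg, hfg, hgi⟩ := aux_major f hfint.aemeasurable
  have hI : ∫ x in ball (0 : Euc n) 1, f x = ∫ x, f x :=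
    setIntegral_eq_integral_of_forall_compl_eq_zero hfout
  have hgI : ∫⁻ x, g x = ENNReal.ofReal (∫ x, f x) := by
    rw [hgi, ofReal_integral_eq_lintegral_ofReal hfint (Filter.Eventually.of_forall hf0)]
  have hI0 : 0 ≤ ∫ x, f x := integral_nonneg hf0
  set F : Euc n × Euc n → ℝ≥0∞ :=
    fun z => 2 * ∫⁻ t in Icc (0:ℝ) 1, g ((1 - t) • z.1 + t • z.2) with hF
  have hm : Measurable (fun p : (Euc n × Euc n) × ℝ =>
      g ((1 - p.2) • p.1.1 + p.2 • p.1.2)) := by fun_prop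
  have hFm : Measurable F := (Measurable.lintegral_prod_right' hm).const_mul 2
  have hBB : MeasurableSet (ball (0 : Euc n) 1 ×ˢ ball (0 : Euc n) 1) :=
    measurableSet_ball.prod measurableSet_ball
  have hsub : {z : Euc n × Euc n | z.1 ∈ ball (0 : Euc n) 1 ∧ z.2 ∈ ball (0 : Euc n) 1 ∧
      b < ∫ y in segment ℝ z.1 z.2, f y ∂μH[1]} ⊆
      {z | ENNReal.ofReal b ≤ F z} ∩ (ball (0 : Euc n) 1 ×ˢ ball (0 : Euc n) 1) := by
    rintro ⟨x, y⟩ ⟨hx, hy, hxy⟩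
    refine ⟨?_, hx, hy⟩
    simp only at hx hy hxy
    have hint : Integrable f ((μH[1] : Measure (Euc n)).restrict (segment ℝ x y)) := by
      by_contra h
      rw [integral_undef h] at hxy
      linarith
    have hd : dist x y ≤ 2 := by
      have h1 := dist_triangle_right x y 0
      rw [mem_ball] at hx hy
      linarith
    calc ENNReal.ofReal b ≤ ENNReal.ofReal (∫ y in segment ℝ x y, f y ∂μH[1]) :=
          ENNReal.ofReal_le_ofReal hxy.le
      _ = ∫⁻ y in segment ℝ x y, ENNReal.ofReal (f y) ∂μH[1] :=
          ofReal_integral_eq_lintegral_ofReal hint (Filter.Eventually.of_forall hf0)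
      _ ≤ ∫⁻ y in segment ℝ x y, g y ∂μH[1] := lintegral_mono hfg
      _ ≤ _ := aux_seg g hg x y
      _ ≤ F (x, y) := by
          simp only [hF]
          gcongr
          exact (ENNReal.ofReal_le_ofReal hd).trans (by simp)
  refine (measure_mono hsub).trans ?_
  rw [← Measure.restrict_apply' hBB]
  have hb0 : ENNReal.ofReal b ≠ 0 := by simpa using hb
  refine (meas_ge_le_lintegral_div hFm.aemeasurable hb0 ENNReal.ofReal_ne_top).trans ?_
  refine (ENNReal.div_le_div_right (aux_total g hg) _).trans ?_
  rw [hI, hgI, div_mul_eq_mul_div, ENNReal.ofReal_div_of_pos hb]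
  refine ENNReal.div_le_div_right (le_of_eq ?_) _
  rw [ENNReal.ofReal_mul (by positivity), ENNReal.ofReal_mul (by positivity),
    ENNReal.ofReal_mul (by positivity), ENNReal.ofReal_toReal hVt,
    ENNReal.ofReal_pow (by norm_num), ← hV]
  simp [mul_assoc]
end
end

section
/- Let Ω be a bounded open convex subset of ℝ^n. Then there exists a constant C = C(Ω) such that for every set S ⊂ ℝ^n, the outer Lebesgue measure of { (x,y) ∈ Ω × Ω : [x,y] ∩ S ≠ ∅ } is at most C · H^{n-1}_∞(S), where H^{n-1}_∞(S) := inf{ Σ_i γ_{n-1} s_i^{n-1} : S ⊂ ⋃_i B_{s_i}(x_i) } is the (n−1)-dimensional Hausdorff content (γ_{n-1} the standard normalization constant from the definition of Hausdorff measure). -/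
open MeasureTheory Metric Set Matrix
open scoped ENNReal NNReal RealInnerProductSpace

attribute [local instance] Matrix.frobeniusNormedAddCommGroup

noncomputable section

/-- The normalization constant `γ_k` from the definition of Hausdorff measure:
the Lebesgue volume of the unit ball of `ℝ^k`. -/
def gammaConst (k : ℕ) : ℝ≥0∞ := volume (ball (0 : EuclideanSpace ℝ (Fin k)) 1)

/-- The `(n-1)`-dimensional Hausdorff content
`H^{n-1}_∞(S) = inf { Σ_i γ_{n-1} s_i^{n-1} : S ⊆ ⋃_i B_{s_i}(x_i) }`. -/
def hausdorffContent (n : ℕ) (S : Set (Euc n)) : ℝ≥0∞ :=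
  ⨅ (c : ℕ → Euc n × ℝ) (_ : S ⊆ ⋃ i, ball (c i).1 (c i).2),
    ∑' i, gammaConst (n-1) * ENNReal.ofReal ((c i).2 ^ (n-1))

/-- Pairs in a ball whose segment meets a small ball in the half closer to the second point. -/
def halfSet (n : ℕ) (R : ℝ) (c : Euc n) (s : ℝ) : Set (Euc n × Euc n) :=
  {z | z.1 ∈ ball (0 : Euc n) R ∧ z.2 ∈ ball (0 : Euc n) R ∧
    ∃ t : ℝ, 1/2 ≤ t ∧ t ≤ 1 ∧ (1 - t) • z.1 + t • z.2 ∈ ball c s}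

lemma halfSet_open (n : ℕ) (R : ℝ) (c : Euc n) (s : ℝ) : IsOpen (halfSet n R c s) := by
  have : halfSet n R c s = (ball (0 : Euc n) R ×ˢ ball (0 : Euc n) R) ∩
      ⋃ t ∈ Icc (1/2 : ℝ) 1, (fun z : Euc n × Euc n => (1 - t) • z.1 + t • z.2) ⁻¹' ball c s := by
    ext z
    simp only [halfSet, mem_ofPred_eq, mem_inter_iff, mem_prod, mem_iUnion, mem_preimage, mem_Icc,
      exists_prop, and_assoc]
  rw [this]
  refine (isOpen_ball.prod isOpen_ball).inter (isOpen_biUnion fun t _ => ?_)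
  exact isOpen_ball.preimage (by fun_prop)

lemma slice_bound (n : ℕ) (hn : 1 ≤ n) (R : ℝ) (hR : 0 < R) (c : Euc n) (s : ℝ) (hs : 0 < s)
    (hsR : s ≤ R) (x : Euc n) :
    volume (Prod.mk x ⁻¹' halfSet n R c s) ≤
      ENNReal.ofReal (5 * R * 3 ^ n * s ^ (n-1)) * volume (ball (0 : Euc n) 1) := by
  by_cases hne : (Prod.mk x ⁻¹' halfSet n R c s).Nonempty
  swap
  · rw [not_nonempty_iff_eq_empty.1 hne]; simp
  have hcx : ‖c - x‖ ≤ 3 * R := by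
    obtain ⟨y, hx, hy, t, ht1, ht2, hz⟩ := hne
    simp only [mem_ball_iff_norm, sub_zero] at hx hy hz
    have e : c - x = -((1 - t) • x + t • y - c) + (-(t • x) + t • y) := by
      module
    have h1 : ‖t • x‖ ≤ R := by
      rw [norm_smul, Real.norm_of_nonneg (by linarith)]
      nlinarith [norm_nonneg x]
    have h2 : ‖t • y‖ ≤ R := by
      rw [norm_smul, Real.norm_of_nonneg (by linarith)]
      nlinarith [norm_nonneg y]
    rw [e]
    refine (norm_add_le _ _).trans ?_
    have h3 := norm_add_le (-(t • x)) (t • y)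
    rw [norm_neg] at h3 ⊢
    linarith
  set N : ℕ := ⌈3 * R / s⌉₊ with hN
  have hNle : 3 * R / s ≤ N := Nat.le_ceil _
  have hNpos : (0 : ℝ) < N := lt_of_lt_of_le (by positivity) hNle
  have hNlt : (N : ℝ) < 3 * R / s + 1 := Nat.ceil_lt_add_one (by positivity)
  have hsub : Prod.mk x ⁻¹' halfSet n R c s ⊆
      ⋃ k ∈ Finset.range (N + 1), ball (x + (1 + (k : ℝ) / N) • (c - x)) (3 * s) := by
    rintro y ⟨hx, hy, t, ht1, ht2, hz⟩
    simp only at hx hy hz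
    have ht0 : 0 < t := by linarith
    have hτ1 : 1 ≤ 1 / t := by rw [le_div_iff₀ ht0]; linarith
    have hτ2 : 1 / t ≤ 2 := by rw [div_le_iff₀ ht0]; linarith
    set τ := 1 / t with hτ
    have htτ : τ * t = 1 := by rw [hτ]; field_simp
    have hk0 : 0 ≤ (τ - 1) * N := mul_nonneg (by linarith) hNpos.le
    set k := ⌊(τ - 1) * N⌋₊ with hk
    have hk1 : (k : ℝ) ≤ (τ - 1) * N := Nat.floor_le hk0
    have hk2 : (τ - 1) * N < k + 1 := Nat.lt_floor_add_one _
    have hkN : k ≤ N := by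
      have : (k : ℝ) ≤ N := by nlinarith
      exact_mod_cast this
    simp only [mem_iUnion, exists_prop, Finset.mem_range]
    refine ⟨k, by omega, ?_⟩
    rw [mem_ball_iff_norm] at hz ⊢
    have e : y - (x + (1 + (k : ℝ) / N) • (c - x)) =
        τ • ((1 - t) • x + t • y - c) + (τ - 1 - (k : ℝ) / N) • (c - x) := by
      have : τ • ((1 - t) • x + t • y - c) = (τ - τ * t) • x + (τ * t) • y - τ • c := by module
      rw [this, htτ]; module
    rw [e]
    have hd0 : 0 ≤ τ - 1 - (k : ℝ) / N := by
      rw [sub_nonneg, div_le_iff₀ hNpos]; exact hk1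
    have hd1 : τ - 1 - (k : ℝ) / N ≤ 1 / N := by
      rw [sub_le_iff_le_add, ← add_div, le_div_iff₀ hNpos]; linarith
    have hRN : 3 * R / N ≤ s := by
      rw [div_le_iff₀ hNpos]; rw [div_le_iff₀ hs] at hNle; linarith
    calc _ ≤ ‖τ • ((1 - t) • x + t • y - c)‖ + ‖(τ - 1 - (k : ℝ) / N) • (c - x)‖ :=
          norm_add_le _ _
      _ = τ * ‖(1 - t) • x + t • y - c‖ + (τ - 1 - (k : ℝ) / N) * ‖c - x‖ := by
          rw [norm_smul, norm_smul, Real.norm_of_nonneg hd0, Real.norm_of_nonneg (by linarith)]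
      _ ≤ τ * ‖(1 - t) • x + t • y - c‖ + (1 / N) * (3 * R) := by gcongr
      _ < 2 * s + s := by
          have : (1 / (N:ℝ)) * (3 * R) = 3 * R / N := by ring
          rw [this]
          have := norm_nonneg ((1 - t) • x + t • y - c)
          nlinarith
      _ = 3 * s := by ring
  calc volume (Prod.mk x ⁻¹' halfSet n R c s)
      ≤ volume (⋃ k ∈ Finset.range (N + 1), ball (x + (1 + (k : ℝ) / N) • (c - x)) (3 * s)) :=
        measure_mono hsub
    _ ≤ ∑ k ∈ Finset.range (N + 1), volume (ball (x + (1 + (k : ℝ) / N) • (c - x)) (3 * s)) :=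
        measure_biUnion_finset_le _ _
    _ = ENNReal.ofReal ((N + 1) * (3 * s) ^ n) * volume (ball (0 : Euc n) 1) := by
        have : ∀ k ∈ Finset.range (N + 1),
            volume (ball (x + (1 + (k : ℝ) / N) • (c - x)) (3 * s)) =
            ENNReal.ofReal ((3 * s) ^ n) * volume (ball (0 : Euc n) 1) := by
          intro k _
          rw [Measure.addHaar_ball_of_pos volume _ (by positivity : 0 < 3 * s)]
          simp
        rw [Finset.sum_congr rfl this, Finset.sum_const, Finset.card_range, nsmul_eq_mul,
          ← mul_assoc, ENNReal.ofReal_mul (by positivity)]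
        congr 2
        rw [← Nat.cast_succ, ENNReal.ofReal_natCast]
    _ ≤ _ := by
        refine mul_le_mul_left (ENNReal.ofReal_le_ofReal ?_) _
        obtain ⟨m, rfl⟩ : ∃ m, n = m + 1 := ⟨n - 1, by omega⟩
        have h5 : (N + 1) * s ≤ 5 * R := by
          have : 3 * R / s * s = 3 * R := by field_simp
          nlinarith
        calc ((N : ℝ) + 1) * (3 * s) ^ (m + 1)
            = (((N : ℝ) + 1) * s) * (3 ^ (m + 1) * s ^ m) := by ring
          _ ≤ (5 * R) * (3 ^ (m + 1) * s ^ m) := by gcongr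
          _ = _ := by rw [Nat.add_sub_cancel]; ring

lemma halfSet_bound (n : ℕ) (hn : 1 ≤ n) (R : ℝ) (hR : 0 < R) (c : Euc n) (s : ℝ) (hs : 0 < s)
    (hsR : s ≤ R) :
    volume (halfSet n R c s) ≤
      ENNReal.ofReal (5 * R * 3 ^ n * s ^ (n-1)) * volume (ball (0 : Euc n) 1)
        * volume (ball (0 : Euc n) R) := by
  rw [Measure.volume_eq_prod, Measure.prod_apply (halfSet_open n R c s).measurableSet]
  rw [← setLIntegral_const, ← lintegral_indicator measurableSet_ball]
  refine lintegral_mono fun x => ?_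
  by_cases hx : x ∈ ball (0 : Euc n) R
  · rw [indicator_of_mem hx]; exact slice_bound n hn R hR c s hs hsR x
  · have : Prod.mk x ⁻¹' halfSet n R c s = ∅ := by
      ext y; simp only [mem_preimage, mem_empty_iff_false, iff_false]
      exact fun h => hx h.1
    rw [this]; simp

lemma ball_bound (n : ℕ) (hn : 1 ≤ n) (R : ℝ) (hR : 0 < R) :
    ∃ K : ℝ, 0 < K ∧ ∀ (c : Euc n) (s : ℝ),
      volume {z : Euc n × Euc n | z.1 ∈ ball (0 : Euc n) R ∧ z.2 ∈ ball (0 : Euc n) R ∧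
        (segment ℝ z.1 z.2 ∩ ball c s).Nonempty} ≤ ENNReal.ofReal K * ENNReal.ofReal (s ^ (n-1)) := by
  set V := (volume (ball (0 : Euc n) R)).toReal with hV
  set W := (volume (ball (0 : Euc n) 1)).toReal with hW
  have hV' : volume (ball (0 : Euc n) R) = ENNReal.ofReal V :=
    (ENNReal.ofReal_toReal measure_ball_lt_top.ne).symm
  have hW' : volume (ball (0 : Euc n) 1) = ENNReal.ofReal W :=
    (ENNReal.ofReal_toReal measure_ball_lt_top.ne).symm
  have hV0 : 0 ≤ V := ENNReal.toReal_nonneg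
  have hW0 : 0 ≤ W := ENNReal.toReal_nonneg
  refine ⟨2 * (5 * R * 3 ^ n * W * V) + V * V / R ^ (n-1) + 1, by positivity, fun c s => ?_⟩
  rcases le_or_gt s 0 with hs | hs
  · rw [ball_eq_empty.2 hs]; simp
  rw [← ENNReal.ofReal_mul (by positivity)]
  rcases le_or_gt s R with hsR | hsR
  · have hb := halfSet_bound n hn R hR c s hs hsR
    have hsub : {z : Euc n × Euc n | z.1 ∈ ball (0 : Euc n) R ∧ z.2 ∈ ball (0 : Euc n) R ∧
        (segment ℝ z.1 z.2 ∩ ball c s).Nonempty} ⊆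
        halfSet n R c s ∪ Prod.swap ⁻¹' halfSet n R c s := by
      rintro ⟨x, y⟩ ⟨hx, hy, w, ⟨a, b, ha, hb, hab, rfl⟩, hw⟩
      rcases le_total (1/2) b with h | h
      · left
        refine ⟨hx, hy, b, h, by linarith, ?_⟩
        rwa [show 1 - b = a by linarith]
      · right
        refine ⟨hy, hx, a, by linarith, by linarith, ?_⟩
        rw [show 1 - a = b by linarith, add_comm]
        exact hw
    have hsw : volume (Prod.swap ⁻¹' halfSet n R c s) = volume (halfSet n R c s) := by
      rw [Measure.volume_eq_prod]
      exact Measure.measurePreserving_swap.measure_preimage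
        (halfSet_open n R c s).measurableSet.nullMeasurableSet
    refine (measure_mono hsub).trans ((measure_union_le _ _).trans ?_)
    rw [hsw]
    refine (add_le_add hb hb).trans ?_
    rw [hV', hW', ← ENNReal.ofReal_mul (by positivity), ← ENNReal.ofReal_mul (by positivity),
      ← ENNReal.ofReal_add (by positivity) (by positivity)]
    apply ENNReal.ofReal_le_ofReal
    have h1 : 0 ≤ (V * V / R ^ (n-1) + 1) * s ^ (n-1) := by positivity
    nlinarith
  · have hsub : {z : Euc n × Euc n | z.1 ∈ ball (0 : Euc n) R ∧ z.2 ∈ ball (0 : Euc n) R ∧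
        (segment ℝ z.1 z.2 ∩ ball c s).Nonempty} ⊆ ball (0 : Euc n) R ×ˢ ball (0 : Euc n) R :=
      fun z hz => ⟨hz.1, hz.2.1⟩
    refine (measure_mono hsub).trans ?_
    rw [Measure.volume_eq_prod, Measure.prod_prod, hV', ← ENNReal.ofReal_mul hV0]
    apply ENNReal.ofReal_le_ofReal
    have h1 : 0 ≤ (2 * (5 * R * 3 ^ n * W * V) + 1) * s ^ (n-1) := by positivity
    have h2 : V * V ≤ V * V / R ^ (n-1) * s ^ (n-1) := by
      rw [div_mul_eq_mul_div, le_div_iff₀ (by positivity)]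
      gcongr
    nlinarith

/-- **Pairs of points whose segment meets a small set** (Lemma `L7.7`). -/
theorem measure_pairs_segment_meets_set
    (n : ℕ) (hn : 1 ≤ n)
    (Ω : Set (Euc n)) (hΩo : IsOpen Ω) (hΩb : Bornology.IsBounded Ω) (hΩc : Convex ℝ Ω) :
    ∃ C : ℝ, 0 < C ∧
      ∀ S : Set (Euc n),
        volume {z : Euc n × Euc n | z.1 ∈ Ω ∧ z.2 ∈ Ω ∧ (segment ℝ z.1 z.2 ∩ S).Nonempty}
          ≤ ENNReal.ofReal C * hausdorffContent n S := by
  obtain ⟨R, hR, hΩR⟩ := hΩb.subset_ball_lt 0 (0 : Euc n)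
  obtain ⟨K, hK, hball⟩ := ball_bound n hn R hR
  have hg0 : gammaConst (n-1) ≠ 0 := (measure_ball_pos volume _ one_pos).ne'
  have hgt : gammaConst (n-1) ≠ ∞ := measure_ball_lt_top.ne
  have hgr : 0 < (gammaConst (n-1)).toReal := ENNReal.toReal_pos hg0 hgt
  refine ⟨K / (gammaConst (n-1)).toReal, by positivity, fun S => ?_⟩
  have hCg : ENNReal.ofReal (K / (gammaConst (n-1)).toReal) * gammaConst (n-1)
      = ENNReal.ofReal K := by
    conv_lhs => rw [← ENNReal.ofReal_toReal hgt]
    rw [ENNReal.toReal_ofReal hgr.le, ← ENNReal.ofReal_mul (by positivity)]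
    congr 1
    field_simp
  have hC0 : ENNReal.ofReal (K / (gammaConst (n-1)).toReal) ≠ 0 := by
    rw [Ne, ENNReal.ofReal_eq_zero, not_le]; positivity
  unfold hausdorffContent
  rw [ENNReal.mul_iInf_of_ne hC0 ENNReal.ofReal_ne_top]
  refine le_iInf fun c => ?_
  rw [ENNReal.mul_iInf_of_ne hC0 ENNReal.ofReal_ne_top]
  refine le_iInf fun hc => ?_
  rw [← ENNReal.tsum_mul_left]
  have hsub : {z : Euc n × Euc n | z.1 ∈ Ω ∧ z.2 ∈ Ω ∧ (segment ℝ z.1 z.2 ∩ S).Nonempty} ⊆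
      ⋃ i, {z : Euc n × Euc n | z.1 ∈ ball (0 : Euc n) R ∧ z.2 ∈ ball (0 : Euc n) R ∧
        (segment ℝ z.1 z.2 ∩ ball (c i).1 (c i).2).Nonempty} := by
    rintro z ⟨h1, h2, w, hw, hwS⟩
    obtain ⟨i, hi⟩ := mem_iUnion.1 (hc hwS)
    exact mem_iUnion.2 ⟨i, hΩR h1, hΩR h2, w, hw, hi⟩
  refine (measure_mono hsub).trans ((measure_iUnion_le _).trans (ENNReal.tsum_le_tsum fun i => ?_))
  rw [← mul_assoc, hCg]
  exact hball _ _
end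
end

section
/- For i = 1,…,n let A_i be real n×n matrices with det A_i > 0. Assume there is a set C = {(i_1,j_1),…,(i_{n-1},j_{n-1})} of ordered pairs of indices in {1,…,n} such that SO(n)A_{i_k} is rank-1 connected to SO(n)A_{j_k} for each k, and such that for all i, j ∈ {1,…,n} there is a chain w_0 = i, w_1, …, w_ℓ = j with (w_k, w_{k+1}) ∈ C or (w_{k+1}, w_k) ∈ C for each k. For k = 1,…,n−1 let p_k, q_k ∈ ℝ^n be vectors with p_k·q_k = 0 and A_{i_k}^T A_{i_k} − A_{j_k}^T A_{j_k} = p_k p_k^T − q_k q_k^T. Assume that the family {p_1,…,p_{n-1}, q_1,…,q_{n-1}} contains no linearly dependent subset of n elements. Then for each i ∈ {1,…,n} there exists a unit vector v_i ∈ S^{n-1} such that |A_i v_i| > |A_j v_i| for all j ≠ i. -/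
open MeasureTheory Metric Set Matrix
open scoped ENNReal NNReal RealInnerProductSpace

attribute [local instance] Matrix.frobeniusNormedAddCommGroup

noncomputable section

lemma aux_quad {n : ℕ} (A B : Mat n) (p q v : Fin n → ℝ)
    (h : Aᵀ * A - Bᵀ * B = Matrix.vecMulVec p p - Matrix.vecMulVec q q) :
    (A *ᵥ v) ⬝ᵥ (A *ᵥ v) - (B *ᵥ v) ⬝ᵥ (B *ᵥ v) = (p ⬝ᵥ v) ^ 2 - (q ⬝ᵥ v) ^ 2 := by
  have key : ∀ M : Mat n, (M *ᵥ v) ⬝ᵥ (M *ᵥ v) = v ⬝ᵥ ((Mᵀ * M) *ᵥ v) := by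
    intro M
    rw [← Matrix.mulVec_mulVec, Matrix.dotProduct_mulVec v, Matrix.vecMul_transpose]
  have key2 : ∀ p : Fin n → ℝ, v ⬝ᵥ (Matrix.vecMulVec p p *ᵥ v) = (p ⬝ᵥ v) ^ 2 := by
    intro p
    rw [Matrix.vecMulVec_mulVec]
    simp [dotProduct_comm v p, sq]
  rw [key, key, ← dotProduct_sub, ← Matrix.sub_mulVec, h, Matrix.sub_mulVec, dotProduct_sub,
    key2, key2]

lemma aux_vnorm {n : ℕ} (v : Fin n → ℝ) : vnorm v = Real.sqrt (v ⬝ᵥ v) := by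
  simp [vnorm, dotProduct, sq]

lemma aux_exists (n : ℕ) (hn : 3 ≤ n) (r : Fin (n-1) → (Fin n → ℝ)) :
    ∃ v : Fin n → ℝ, v ≠ 0 ∧ ∀ k, r k ⬝ᵥ v = 0 := by
  have h : LinearMap.ker (Matrix.mulVecLin (Matrix.of r)) ≠ ⊥ := by
    apply LinearMap.ker_ne_bot_of_finrank_lt
    simp
    omega
  obtain ⟨v, hv, h0⟩ := Submodule.exists_mem_ne_zero_of_ne_bot h
  refine ⟨v, h0, fun k => ?_⟩
  exact congrFun (LinearMap.mem_ker.1 hv) k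

lemma aux_ne (n : ℕ) (hn : 3 ≤ n) (F : Fin (n-1) ⊕ Fin (n-1) → (Fin n → ℝ))
    (hindep : ∀ s : Finset (Fin (n-1) ⊕ Fin (n-1)), s.card = n →
      LinearIndependent ℝ (fun i : {x // x ∈ s} => F i.1))
    (c : Fin (n-1) → Fin (n-1) ⊕ Fin (n-1)) (hc : Function.Injective c)
    (v : Fin n → ℝ) (hv0 : v ≠ 0) (hv : ∀ k, F (c k) ⬝ᵥ v = 0)
    (o : Fin (n-1) ⊕ Fin (n-1)) (ho : ∀ k, c k ≠ o) : F o ⬝ᵥ v ≠ 0 := by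
  classical
  intro h
  have ho' : o ∉ Finset.univ.image c := by simpa using ho
  have hcard : (insert o (Finset.univ.image c)).card = n := by
    rw [Finset.card_insert_of_notMem ho', Finset.card_image_of_injective _ hc]
    simp
    omega
  have hs := (hindep _ hcard).span_eq_top_of_card_eq_finrank' (by rw [Fintype.card_coe, hcard]; simp)
  apply hv0
  rw [← dotProduct_self_eq_zero]
  have hmem : v ∈ Submodule.span ℝ (Set.range
      (fun i : {x // x ∈ insert o (Finset.univ.image c)} => F i.1)) := by
    rw [hs]; trivial
  have : ∀ x ∈ Submodule.span ℝ (Set.range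
      (fun i : {x // x ∈ insert o (Finset.univ.image c)} => F i.1)), x ⬝ᵥ v = 0 := by
    intro x hx
    induction hx using Submodule.span_induction with
    | mem x hx =>
      obtain ⟨⟨i, hi⟩, rfl⟩ := hx
      rcases Finset.mem_insert.1 hi with rfl | hi
      · exact h
      · obtain ⟨k, -, rfl⟩ := Finset.mem_image.1 hi
        exact hv k
    | zero => simp
    | add x y _ _ hx hy => rw [add_dotProduct, hx, hy, add_zero]
    | smul a x _ hx => rw [smul_dotProduct, hx, smul_zero]
  exact this v hmem

/-- **Generic totally rank-1 connected families of `n` wells in `ℝ^n` satisfy the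
separation condition** (Theorem `T.generic`). -/
theorem generic_rank_one_connected
    (n : ℕ) (hn : 3 ≤ n)
    (A : Fin n → Mat n) (hA : ∀ i, 0 < (A i).det)
    (ik jk : Fin (n-1) → Fin n)
    (hconn : ∀ k, ∃ X ∈ well (A (ik k)), ∃ Y ∈ well (A (jk k)), (X - Y).rank = 1)
    (hchain : ∀ i j : Fin n, ∃ (ℓ : ℕ) (w : ℕ → Fin n), w 0 = i ∧ w ℓ = j ∧
      ∀ k < ℓ, (∃ t, ik t = w k ∧ jk t = w (k+1)) ∨ (∃ t, ik t = w (k+1) ∧ jk t = w k))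
    (pv qv : Fin (n-1) → (Fin n → ℝ))
    (horth : ∀ k, pv k ⬝ᵥ qv k = 0)
    (heq : ∀ k, (A (ik k))ᵀ * A (ik k) - (A (jk k))ᵀ * A (jk k)
      = Matrix.vecMulVec (pv k) (pv k) - Matrix.vecMulVec (qv k) (qv k))
    (hindep : ∀ s : Finset (Fin (n-1) ⊕ Fin (n-1)), s.card = n →
      LinearIndependent ℝ (fun i : {x // x ∈ s} => Sum.elim pv qv i.1)) :
    ∀ i, ∃ v : Fin n → ℝ, vnorm v = 1 ∧
      ∀ j, j ≠ i → vnorm ((A j).mulVec v) < vnorm ((A i).mulVec v) := by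
  classical
  intro i
  have hex : ∀ j : Fin n, ∃ (ℓ : ℕ), ∃ (w : ℕ → Fin n), w 0 = i ∧ w ℓ = j ∧
      ∀ k < ℓ, (∃ t, ik t = w k ∧ jk t = w (k+1)) ∨ (∃ t, ik t = w (k+1) ∧ jk t = w k) :=
    hchain i
  obtain ⟨d, hd⟩ : ∃ d : Fin n → ℕ, ∀ j, j ≠ i → ∃ m, d m < d j ∧
      ∃ t, (ik t = m ∧ jk t = j) ∨ (ik t = j ∧ jk t = m) := by
    refine ⟨fun j => Nat.find (hex j), fun j hj => ?_⟩
    obtain ⟨w, h0, hl, hw⟩ := Nat.find_spec (hex j)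
    have hpos : Nat.find (hex j) ≠ 0 := by
      intro h
      rw [h] at hl
      exact hj (hl.symm.trans h0)
    obtain ⟨l, hl'⟩ := Nat.exists_eq_succ_of_ne_zero hpos
    rw [hl'] at hl hw
    refine ⟨w l, ?_, ?_⟩
    · have : Nat.find (hex (w l)) ≤ l :=
        Nat.find_min' _ ⟨w, h0, rfl, fun k hk => hw k (by omega)⟩
      show Nat.find (hex (w l)) < Nat.find (hex j)
      omega
    · rcases hw l (Nat.lt_succ_self l) with ⟨t, h1, h2⟩ | ⟨t, h1, h2⟩
      · exact ⟨t, Or.inl ⟨h1, h2.trans hl⟩⟩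
      · exact ⟨t, Or.inr ⟨h1.trans hl, h2⟩⟩
  let c : Fin (n-1) → Fin (n-1) ⊕ Fin (n-1) := fun k =>
    if d (ik k) < d (jk k) then Sum.inr k else Sum.inl k
  have hc : Function.Injective c := by
    intro a b hab
    simp only [c] at hab
    split_ifs at hab <;> simpa using hab
  obtain ⟨v, hv0, hv⟩ := aux_exists n hn (fun k => Sum.elim pv qv (c k))
  have hne := aux_ne n hn (Sum.elim pv qv) hindep c hc v hv0 hv
  have hstep : ∀ j, j ≠ i → ∃ m, d m < d j ∧
      (A j *ᵥ v) ⬝ᵥ (A j *ᵥ v) < (A m *ᵥ v) ⬝ᵥ (A m *ᵥ v) := by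
    intro j hj
    obtain ⟨m, hm, t, ht⟩ := hd j hj
    refine ⟨m, hm, ?_⟩
    have hq := aux_quad _ _ _ _ v (heq t)
    have hvt := hv t
    rcases ht with ⟨h1, h2⟩ | ⟨h1, h2⟩
    · have hct : c t = Sum.inr t := by simp [c, h1, h2, hm]
      have hp : pv t ⬝ᵥ v ≠ 0 := by
        refine hne (Sum.inl t) fun k hk => ?_
        have : k = t := by
          simp only [c] at hk
          split_ifs at hk
          simpa using hk
        subst this
        rw [hct] at hk
        cases hk
      simp only [hct, Sum.elim_inr] at hvt
      rw [hvt, h1, h2] at hq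
      have := pow_pos (abs_pos.2 hp) 2
      rw [sq_abs] at this
      linarith
    · have hct : c t = Sum.inl t := by simp [c, h1, h2, hm.le]
      have hp : qv t ⬝ᵥ v ≠ 0 := by
        refine hne (Sum.inr t) fun k hk => ?_
        have : k = t := by
          simp only [c] at hk
          split_ifs at hk
          simpa using hk
        subst this
        rw [hct] at hk
        cases hk
      simp only [hct, Sum.elim_inl] at hvt
      rw [hvt, h1, h2] at hq
      have := pow_pos (abs_pos.2 hp) 2
      rw [sq_abs] at this
      linarith
  have hall : ∀ N j, d j = N → j ≠ i →
      (A j *ᵥ v) ⬝ᵥ (A j *ᵥ v) < (A i *ᵥ v) ⬝ᵥ (A i *ᵥ v) := by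
    intro N
    induction N using Nat.strong_induction_on with
    | _ N ih =>
      intro j hN hj
      obtain ⟨m, hm, hlt⟩ := hstep j hj
      by_cases hmi : m = i
      · rwa [hmi] at hlt
      · exact hlt.trans (ih (d m) (hN ▸ hm) m rfl hmi)
  have hvv : 0 < v ⬝ᵥ v := lt_of_le_of_ne
    (Finset.sum_nonneg fun k _ => mul_self_nonneg (v k))
    (fun h => hv0 (dotProduct_self_eq_zero.1 h.symm))
  set a := (Real.sqrt (v ⬝ᵥ v))⁻¹ with ha
  have hapos : 0 < a := inv_pos.2 (Real.sqrt_pos.2 hvv)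
  have ha2 : a * (a * (v ⬝ᵥ v)) = 1 := by
    have := Real.mul_self_sqrt hvv.le
    have h3 := (Real.sqrt_pos.2 hvv).ne'
    rw [ha]
    field_simp
    nlinarith
  refine ⟨a • v, ?_, fun j hj => ?_⟩
  · rw [aux_vnorm]
    simp only [smul_dotProduct, dotProduct_smul, smul_eq_mul, ha2, Real.sqrt_one]
  · rw [aux_vnorm, aux_vnorm]
    apply Real.sqrt_lt_sqrt
    · exact Finset.sum_nonneg fun k _ => mul_self_nonneg _
    · simp only [Matrix.mulVec_smul, smul_dotProduct, dotProduct_smul, smul_eq_mul]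
      have := hall _ j rfl hj
      gcongr
end
end

section
/- Let A and B be real n×n matrices with det A > 0 and det B > 0. Then there exist X ∈ SO(n)A and Y ∈ SO(n)B with rank(X − Y) = 1 if and only if there exist vectors p, q ∈ ℝ^n, at least one of which is nonzero, such that p·q = 0 and A^T A − B^T B = p p^T − q q^T. -/
open MeasureTheory Metric Set Matrix
open scoped ENNReal NNReal RealInnerProductSpace

attribute [local instance] Matrix.frobeniusNormedAddCommGroup

noncomputable section

lemma rk_exists {n : ℕ} (M : Mat n) (h : M.rank = 1) :
    ∃ a b : Fin n → ℝ, a ≠ 0 ∧ b ≠ 0 ∧ M = vecMulVec a b := by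
  have h1 := h
  rw [Matrix.rank, finrank_eq_one_iff'] at h1
  obtain ⟨⟨a, ha'⟩, ha, hc⟩ := h1
  have hc' : ∀ j, ∃ c : ℝ, c • a = M *ᵥ Pi.single j 1 := by
    intro j
    obtain ⟨c, hc⟩ := hc ⟨M *ᵥ Pi.single j 1, ⟨Pi.single j 1, rfl⟩⟩
    exact ⟨c, congrArg Subtype.val hc⟩
  choose b hb using hc'
  have hM : M = vecMulVec a b := by
    ext i j
    have := congrFun (hb j) i
    simp at this
    rw [vecMulVec_apply, ← this, mul_comm]
  refine ⟨a, b, fun h0 => ha (Subtype.ext h0), ?_, hM⟩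
  rintro rfl
  rw [hM] at h
  simp at h

lemma rk_vec {n : ℕ} (a b : Fin n → ℝ) (ha : a ≠ 0) (hb : b ≠ 0) :
    (vecMulVec a b).rank = 1 := by
  have h1 := rank_vecMulVec_le a b
  have h2 : (vecMulVec a b).rank ≠ 0 := by
    intro h
    rw [Matrix.rank, Submodule.finrank_eq_zero, LinearMap.range_eq_bot] at h
    apply vecMulVec_ne_zero ha hb
    ext i j
    have := congrFun (LinearMap.congr_fun h (Pi.single j 1)) i
    simpa using this
  omega

lemma gram_add {n : ℕ} (Y : Mat n) (a b : Fin n → ℝ) :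
    (Y + vecMulVec a b)ᵀ * (Y + vecMulVec a b) =
      Yᵀ * Y + (vecMulVec b (Yᵀ *ᵥ a + ((a ⬝ᵥ a) / 2) • b)
        + vecMulVec (Yᵀ *ᵥ a + ((a ⬝ᵥ a) / 2) • b) b) := by
  rw [transpose_add, transpose_vecMulVec, add_mul, mul_add, mul_add, mul_vecMulVec, vecMulVec_mul,
    vecMulVec_mul_vecMulVec, ← mulVec_transpose]
  ext i j
  simp [vecMulVec_apply]
  ring

lemma det_one_vec {n : ℕ} (Y : Mat n) (a m : Fin n → ℝ) :
    (Y + vecMulVec a (Yᵀ *ᵥ m)).det = Y.det * (1 + m ⬝ᵥ a) := by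
  have : Y + vecMulVec a (Yᵀ *ᵥ m) = (1 + vecMulVec a m) * Y := by
    rw [add_mul, one_mul, vecMulVec_mul, mulVec_transpose]
  rw [this, det_mul, vecMulVec_eq Unit, det_one_add_replicateCol_mul_replicateRow, mul_comm]

lemma det_two_vec {n : ℕ} (Y : Mat n) (e m : Fin n → ℝ) :
    (Yᵀ * Y + (vecMulVec (Yᵀ *ᵥ m) (Yᵀ *ᵥ e) + vecMulVec (Yᵀ *ᵥ e) (Yᵀ *ᵥ m))).det
      = Y.det ^ 2 * ((1 + m ⬝ᵥ e) ^ 2 - (m ⬝ᵥ m) * (e ⬝ᵥ e)) := by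
  have h1 : Yᵀ * Y + (vecMulVec (Yᵀ *ᵥ m) (Yᵀ *ᵥ e) + vecMulVec (Yᵀ *ᵥ e) (Yᵀ *ᵥ m))
      = Yᵀ * (1 + (Matrix.of ![m, e])ᵀ * Matrix.of ![e, m]) * Y := by
    have : (Matrix.of ![m, e])ᵀ * Matrix.of ![e, m] = vecMulVec m e + vecMulVec e m := by
      ext i j
      simp [mul_apply, vecMulVec_apply]
    rw [this, mul_add, add_mul, mul_add, add_mul, mul_vecMulVec, mul_vecMulVec, vecMulVec_mul,
      vecMulVec_mul, ← mulVec_transpose, ← mulVec_transpose, mul_one]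
  have h2 : (1 + Matrix.of ![e, m] * (Matrix.of ![m, e])ᵀ).det =
      (1 + m ⬝ᵥ e) ^ 2 - (m ⬝ᵥ m) * (e ⬝ᵥ e) := by
    have h3 : Matrix.of ![e, m] * (Matrix.of ![m, e])ᵀ =
        !![e ⬝ᵥ m, e ⬝ᵥ e; m ⬝ᵥ m, m ⬝ᵥ e] := by
      ext i j
      fin_cases i <;> fin_cases j <;> rfl
    rw [h3, dotProduct_comm e m]
    simp [det_fin_two]
    ring
  rw [h1, det_mul, det_mul, det_transpose, det_one_add_mul_comm, h2]
  ring

lemma solve_T {n : ℕ} (Y : Mat n) (hY : 0 < Y.det) (b : Fin n → ℝ) : ∃ m, Yᵀ *ᵥ m = b := by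
  refine ⟨(Yᵀ)⁻¹ *ᵥ b, ?_⟩
  rw [mulVec_mulVec, mul_nonsing_inv _ (by rw [det_transpose]; exact hY.ne'.isUnit), one_mulVec]

lemma mem_well_of_gram {n : ℕ} (A X : Mat n) (hA : 0 < A.det) (hX : 0 < X.det)
    (h : Xᵀ * X = Aᵀ * A) : X ∈ well A := by
  have hu : IsUnit A.det := hA.ne'.isUnit
  refine ⟨X * A⁻¹, ⟨?_, ?_⟩, ?_⟩
  · rw [transpose_mul, mul_assoc, ← mul_assoc Xᵀ, h, mul_assoc, mul_nonsing_inv _ hu, mul_one,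
      transpose_nonsing_inv, nonsing_inv_mul _ (by rwa [det_transpose])]
  · have hd : X.det = A.det := by
      have := congrArg Matrix.det h
      simp only [det_mul, det_transpose] at this
      nlinarith
    rw [det_mul, hd, ← det_mul, mul_nonsing_inv _ hu, det_one]
  · simp only [mul_assoc, nonsing_inv_mul _ hu, mul_one]

lemma well_gram {n : ℕ} (A X : Mat n) (hA : 0 < A.det) (h : X ∈ well A) :
    Xᵀ * X = Aᵀ * A ∧ 0 < X.det := by
  obtain ⟨Q, ⟨h1, h2⟩, rfl⟩ := h
  constructor
  · simp only [transpose_mul]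
    rw [mul_assoc, ← mul_assoc Qᵀ, h1, one_mul]
  · simpa [h2] using hA

lemma forward_aux {n : ℕ} (b d : Fin n → ℝ) (hb : b ≠ 0) (hd : d ≠ 0) :
    ∃ p q : Fin n → ℝ, (p ≠ 0 ∨ q ≠ 0) ∧ p ⬝ᵥ q = 0 ∧
      vecMulVec b d + vecMulVec d b = Matrix.vecMulVec p p - Matrix.vecMulVec q q := by
  have hb2 : 0 < b ⬝ᵥ b := by
    have := dotProduct_star_self_pos_iff.2 hb
    simpa using this
  have hd2 : 0 < d ⬝ᵥ d := by
    have := dotProduct_star_self_pos_iff.2 hd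
    simpa using this
  obtain ⟨u, hu, hub⟩ : ∃ u : ℝ, 0 < u ∧ u ^ 2 * u ^ 2 * (4 * (b ⬝ᵥ b)) = d ⬝ᵥ d := by
    refine ⟨√√((d ⬝ᵥ d) / (4 * (b ⬝ᵥ b))), by positivity, ?_⟩
    rw [Real.sq_sqrt (by positivity), Real.mul_self_sqrt (by positivity)]
    field_simp
  set v := 1 / (2 * u) with hv
  have huv : 2 * u * v = 1 := by rw [hv]; field_simp
  have hbd : u ^ 2 * (b ⬝ᵥ b) = v ^ 2 * (d ⬝ᵥ d) := by
    rw [← hub, hv]; field_simp; norm_num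
  refine ⟨u • b + v • d, u • b - v • d, ?_, ?_, ?_⟩
  · by_contra! h
    obtain ⟨h1, h2⟩ := h
    have h3 : (2 * u) • b = 0 := by
      have : (2 * u) • b = (u • b + v • d) + (u • b - v • d) := by
        ext i; simp; ring
      rw [this, h1, h2, add_zero]
    rcases smul_eq_zero.1 h3 with h | h
    · linarith
    · exact hb h
  · simp only [add_dotProduct, dotProduct_sub, smul_dotProduct, dotProduct_smul, smul_eq_mul,
      dotProduct_comm d b]
    linear_combination hbd
  · ext i j
    simp [vecMulVec_apply]
    linear_combination (-(b i * d j + d i * b j)) * huv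

/-- **Characterization of rank-1 connected positive wells** (Lemma `quad.r1c`). -/
theorem rank_one_connection_iff
    (n : ℕ) (hn : 2 ≤ n) (A B : Mat n) (hA : 0 < A.det) (hB : 0 < B.det) :
    (∃ X ∈ well A, ∃ Y ∈ well B, (X - Y).rank = 1) ↔
    (∃ p q : Fin n → ℝ, (p ≠ 0 ∨ q ≠ 0) ∧ p ⬝ᵥ q = 0 ∧
      Aᵀ * A - Bᵀ * B = Matrix.vecMulVec p p - Matrix.vecMulVec q q) := by
  constructor
  · rintro ⟨X, hX, Y, hY, hr⟩
    obtain ⟨hXA, hXd⟩ := well_gram A X hA hX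
    obtain ⟨hYB, hYd⟩ := well_gram B Y hB hY
    obtain ⟨a, b, ha, hb, hab⟩ := rk_exists _ hr
    have hXe : X = Y + vecMulVec a b := by rw [← hab]; abel
    have hg := gram_add Y a b
    rw [← hXe] at hg
    rw [← hXA, ← hYB, hg, add_sub_cancel_left]
    apply forward_aux b _ hb
    intro hd
    have ha2 : 0 < a ⬝ᵥ a := by
      have := dotProduct_star_self_pos_iff.2 ha
      simpa using this
    have hb' : b = Yᵀ *ᵥ ((-2 / (a ⬝ᵥ a)) • a) := by
      rw [mulVec_smul, eq_neg_of_add_eq_zero_left hd, smul_neg, smul_smul]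
      ext i
      simp
      field_simp
    have h1 := det_one_vec Y a ((-2 / (a ⬝ᵥ a)) • a)
    rw [← hb', ← hXe, smul_dotProduct, smul_eq_mul, div_mul_cancel₀ _ ha2.ne'] at h1
    linarith
  · rintro ⟨p, q, hpq, hdot, hg⟩
    have hpp : ∀ x : Fin n → ℝ, x ⬝ᵥ x = 0 → x = 0 := fun x hx => dotProduct_self_eq_zero.1 hx
    have hb : p + q ≠ 0 := by
      intro h
      have h1 : q = -p := by rw [eq_neg_iff_add_eq_zero, add_comm, h]
      subst h1
      have := hpp p (by simpa using hdot)
      simp [this] at hpq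
    have hd : (2⁻¹ : ℝ) • (p - q) ≠ 0 := by
      intro h
      have h1 : p - q = 0 := by simpa using h
      have h1 : p = q := sub_eq_zero.1 h1
      subst h1
      have := hpp p (by simpa using hdot)
      simp [this] at hpq
    have hA2 : Aᵀ * A = Bᵀ * B + (vecMulVec (p + q) ((2⁻¹ : ℝ) • (p - q))
        + vecMulVec ((2⁻¹ : ℝ) • (p - q)) (p + q)) := by
      rw [← sub_eq_iff_eq_add', hg]
      ext i j
      simp [vecMulVec_apply]
      ring
    obtain ⟨m, hm⟩ := solve_T B hB (p + q)
    obtain ⟨e, he⟩ := solve_T B hB ((2⁻¹ : ℝ) • (p - q))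
    rw [← hm, ← he] at hA2
    rw [← hm] at hb
    rw [← he] at hd
    have hdet := congrArg Matrix.det hA2
    rw [det_two_vec, det_mul, det_transpose] at hdet
    have hdisc : 0 < (1 + m ⬝ᵥ e) ^ 2 - (m ⬝ᵥ m) * (e ⬝ᵥ e) := by
      have h1 : 0 < A.det * A.det := by positivity
      rw [hdet] at h1
      exact pos_of_mul_pos_right h1 (by positivity)
    have hm0 : m ⬝ᵥ m ≠ 0 := by
      intro h
      rw [hpp m h] at hb
      simp at hb
    obtain ⟨S, hS, hS2⟩ : ∃ S : ℝ, 0 < S ∧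
        S ^ 2 = (1 + m ⬝ᵥ e) ^ 2 - (m ⬝ᵥ m) * (e ⬝ᵥ e) :=
      ⟨_, Real.sqrt_pos.2 hdisc, Real.sq_sqrt hdisc.le⟩
    obtain ⟨k, hk⟩ : ∃ k : ℝ, k * (m ⬝ᵥ m) = 1 + m ⬝ᵥ e - S :=
      ⟨_, div_mul_cancel₀ _ hm0⟩
    have hk2 : (e - k • m) ⬝ᵥ (e - k • m) = 2 * k := by
      apply mul_left_cancel₀ hm0
      simp only [sub_dotProduct, dotProduct_sub, smul_dotProduct, dotProduct_smul, smul_eq_mul,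
        dotProduct_comm e m]
      linear_combination (k * (m ⬝ᵥ m) - (1 + m ⬝ᵥ e) - S) * hk + hS2
    have hda : Bᵀ *ᵥ (e - k • m) + (((e - k • m) ⬝ᵥ (e - k • m)) / 2) • (Bᵀ *ᵥ m) = Bᵀ *ᵥ e := by
      rw [hk2, mulVec_sub, mulVec_smul, mul_div_cancel_left₀ _ two_ne_zero, sub_add_cancel]
    have ha : e - k • m ≠ 0 := by
      intro h
      rw [h] at hda
      simp at hda
      exact hd hda.symm
    have hgr := gram_add B (e - k • m) (Bᵀ *ᵥ m)
    rw [hda, ← hA2] at hgr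
    refine ⟨B + vecMulVec (e - k • m) (Bᵀ *ᵥ m), mem_well_of_gram A _ hA ?_ hgr, B,
      mem_well_of_gram B B hB hB rfl, ?_⟩
    · rw [det_one_vec]
      have : 1 + m ⬝ᵥ (e - k • m) = S := by
        simp only [dotProduct_sub, dotProduct_smul, smul_eq_mul]
        linarith
      rw [this]
      positivity
    · rw [add_sub_cancel_left]
      exact rk_vec _ _ ha hb
end
end

section
/- Let A be an invertible real n×n matrix, b > 0, and ε > 0. Suppose z_0, z_1, …, z_n ∈ B_1 ⊂ ℝ^n and ζ_0, ζ_1, …, ζ_n ∈ ℝ^n are points such that B_b(y) ⊂ conv{z_0,…,z_n} for some y ∈ B_1, and | |ζ_i − ζ_j| − |A(z_i − z_j)| | ≤ ε for all i ≠ j in {0,…,n}. Then there exist an affine map l_O : ℝ^n → ℝ^n with Dl_O = O ∈ O(n)A (i.e. O = QA for some orthogonal Q) and a constant C = C(b, n, A) such that |ζ_i − l_O(z_i)| ≤ C ε for all i ∈ {0,…,n}. Furthermore, if z ∈ B_1 and ζ ∈ ℝ^n are any other points with | |ζ_i − ζ| − |A(z_i − z)| | ≤ ε for all i ∈ {0,…,n},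 then |ζ − l_O(z)| ≤ C ε for the same affine map l_O, with C = C(n, b, A). -/
open MeasureTheory Metric Set Matrix
open scoped ENNReal NNReal RealInnerProductSpace

attribute [local instance] Matrix.frobeniusNormedAddCommGroup

noncomputable section

/-- The orthogonal group `O(n)` as a set of matrices. -/
def On (n : ℕ) : Set (Mat n) := {Q | Qᵀ * Q = 1}


/-- Approximation of an almost-isometry by an isometry. -/
lemma exists_isometry_near {n : ℕ} (F : Euc n →L[ℝ] Euc n) (δ : ℝ) (hδ : δ ≤ 1/2)
    (hF : ∀ x, ‖(ContinuousLinearMap.adjoint F) (F x) - x‖ ≤ δ * ‖x‖) :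
    ∃ Q : Euc n ≃ₗᵢ[ℝ] Euc n, ∀ x, ‖F x - Q x‖ ≤ n * δ * ‖x‖ := by
  classical
  have hsym : ((ContinuousLinearMap.adjoint F ∘L F : Euc n →L[ℝ] Euc n) : Euc n →ₗ[ℝ] Euc n).IsSymmetric := by
    intro x y
    simp [ContinuousLinearMap.adjoint_inner_left, ContinuousLinearMap.adjoint_inner_right]
  have hfr : Module.finrank ℝ (Euc n) = n := by simp
  let e := hsym.eigenvectorBasis hfr
  let l := hsym.eigenvalues hfr
  have he : ∀ k, ContinuousLinearMap.adjoint F (F (e k)) = l k • e k := by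
    intro k
    have := hsym.apply_eigenvectorBasis hfr k
    exact this
  have hl : ∀ k, |l k - 1| ≤ δ := by
    intro k
    have h := hF (e k)
    have h1 : l k • e k - e k = (l k - 1) • e k := by rw [sub_smul, one_smul]
    rw [he, h1, norm_smul, e.norm_eq_one] at h
    simpa using h
  have hpos : ∀ k, 0 < l k := by
    intro k
    have := abs_le.1 (hl k)
    linarith [this.1]
  have hin : ∀ j k, ⟪F (e j), F (e k)⟫ = if j = k then l k else 0 := by
    intro j k
    rw [← ContinuousLinearMap.adjoint_inner_right, he, inner_smul_right, e.inner_eq_ite]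
    simp
  let f : Fin n → Euc n := fun k => (Real.sqrt (l k))⁻¹ • F (e k)
  have hf : Orthonormal ℝ f := by
    rw [orthonormal_iff_ite]
    intro j k
    simp only [f, inner_smul_left, inner_smul_right, hin]
    split_ifs with h
    · subst h
      have := Real.sqrt_pos.2 (hpos j)
      have h2 := Real.mul_self_sqrt (hpos j).le
      simp only [conj_trivial]
      field_simp
      nlinarith
    · simp
  have hcard : Fintype.card (Fin n) = Module.finrank ℝ (Euc n) := by simp
  let fb : OrthonormalBasis (Fin n) ℝ (Euc n) := OrthonormalBasis.mk hf (by
    rw [hf.linearIndependent.span_eq_top_of_card_eq_finrank' hcard])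
  have hfb : ∀ k, fb k = f k := fun k => by simp [fb]
  let Q := e.equiv fb (Equiv.refl _)
  have hQ : ∀ k, Q (e k) = f k := fun k => by simp [Q, hfb]
  have hk : ∀ k, ‖F (e k) - Q (e k)‖ ≤ δ := by
    intro k
    have hs := Real.sqrt_pos.2 (hpos k)
    have h2 := Real.mul_self_sqrt (hpos k).le
    have h1 : F (e k) - Q (e k) = (Real.sqrt (l k) - 1) • f k := by
      rw [hQ, sub_smul, one_smul]
      simp only [f, smul_smul, mul_inv_cancel₀ hs.ne', one_smul]
    rw [h1, norm_smul, hf.1, mul_one, Real.norm_eq_abs]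
    refine le_trans ?_ (hl k)
    have h3 : l k - 1 = (Real.sqrt (l k) - 1) * (Real.sqrt (l k) + 1) := by linarith
    rw [h3, abs_mul, abs_of_pos (by linarith : 0 < Real.sqrt (l k) + 1)]
    nlinarith [abs_nonneg (Real.sqrt (l k) - 1)]
  refine ⟨Q, fun x => ?_⟩
  have hx : F x - Q x = ∑ k, (e.repr x k) • (F (e k) - Q (e k)) := by
    conv_lhs => rw [← e.sum_repr x]
    simp [map_sum, map_smul, smul_sub, Finset.sum_sub_distrib]
  rw [hx]
  refine (norm_sum_le _ _).trans ?_
  have : ∀ k ∈ Finset.univ, ‖(e.repr x k) • (F (e k) - Q (e k))‖ ≤ δ * ‖x‖ := by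
    intro k _
    rw [norm_smul, mul_comm]
    have h1 : ‖e.repr x k‖ ≤ ‖x‖ := by
      rw [e.repr_apply_apply]
      refine (norm_inner_le_norm _ _).trans ?_
      rw [e.norm_eq_one, one_mul]
    exact mul_le_mul (hk k) h1 (norm_nonneg _) ((norm_nonneg _).trans (hk k))
  refine (Finset.sum_le_card_nsmul _ _ _ this).trans ?_
  simp [mul_assoc]

lemma polar_est {E : Type*} [NormedAddCommGroup E] [InnerProductSpace ℝ E]
    (R ε : ℝ) (hε : 0 < ε) (hε1 : ε ≤ 1) (p q v w : E)
    (hv : ‖v‖ ≤ R) (hw : ‖w‖ ≤ R) (hvw : ‖v - w‖ ≤ R)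
    (h1 : |‖p‖ - ‖v‖| ≤ ε) (h2 : |‖q‖ - ‖w‖| ≤ ε) (h3 : |‖p - q‖ - ‖v - w‖| ≤ ε) :
    |⟪p, q⟫ - ⟪v, w⟫| ≤ (3 * R + 2) * ε := by
  have key : ∀ a c : ℝ, 0 ≤ a → 0 ≤ c → c ≤ R → |a - c| ≤ ε → |a * a - c * c| ≤ (2 * R + 1) * ε := by
    intro a c ha hc hcR h
    have : a * a - c * c = (a + c) * (a - c) := by ring
    rw [this, abs_mul, abs_of_nonneg (by linarith)]
    have h' := abs_le.1 h
    exact mul_le_mul (by linarith [h'.2]) h (abs_nonneg _) (by linarith)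
  have k1 := abs_le.1 (key _ _ (norm_nonneg p) (norm_nonneg v) hv h1)
  have k2 := abs_le.1 (key _ _ (norm_nonneg q) (norm_nonneg w) hw h2)
  have k3 := abs_le.1 (key _ _ (norm_nonneg (p - q)) (norm_nonneg (v - w)) hvw h3)
  rw [real_inner_eq_norm_mul_self_add_norm_mul_self_sub_norm_sub_mul_self_div_two,
    real_inner_eq_norm_mul_self_add_norm_mul_self_sub_norm_sub_mul_self_div_two, abs_le]
  constructor <;> nlinarith [k1.1, k1.2, k2.1, k2.2, k3.1, k3.2]

lemma core_small {n : ℕ} (K R : ℝ) (hK : 0 < K) (hR : 0 < R) (ε : ℝ) (hε : 0 < ε) (hε1 : ε ≤ 1)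
    (hε2 : K * (K * ((3 * R + 2) * ε)) ≤ 1 / 2) (w ζ : Fin (n+1) → Euc n)
    (H : ∀ (u : Euc n) (δ : ℝ), (∀ i, |⟪w i - w 0, u⟫| ≤ δ) → ‖u‖ ≤ K * δ)
    (hw : ∀ i j, ‖w i - w j‖ ≤ R)
    (hζ : ∀ i j, |‖ζ i - ζ j‖ - ‖w i - w j‖| ≤ ε) :
    ∃ Q : Euc n ≃ₗᵢ[ℝ] Euc n, ∀ w' ζ' : Euc n, (∀ i, ‖w i - w'‖ ≤ R) →
      (∀ i, |‖ζ i - ζ'‖ - ‖w i - w'‖| ≤ ε) →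
      ‖ζ' - ζ 0 - Q (w' - w 0)‖
        ≤ (K * ((3 * R + 2) + (n * (K * (K * (3 * R + 2))) * R) * (R + 1))) * ε := by
  classical
  -- the linear map F
  have hspan : Submodule.span ℝ (Set.range fun i : Fin n => w i.succ - w 0) = ⊤ := by
    rw [← Submodule.orthogonal_eq_bot_iff, Submodule.eq_bot_iff]
    intro u hu
    have : ‖u‖ ≤ K * 0 := by
      apply H
      intro i
      refine Fin.cases ?_ (fun i => ?_) i
      · simp
      · rw [(Submodule.mem_orthogonal _ _).1 hu _ (Submodule.subset_span ⟨i, rfl⟩)]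
        simp
    rw [mul_zero] at this
    exact norm_le_zero_iff.1 this
  let B : Module.Basis (Fin n) ℝ (Euc n) :=
    Module.Basis.mk (linearIndependent_of_top_le_span_of_card_eq_finrank hspan.ge (by simp)) hspan.ge
  let F0 : Euc n →ₗ[ℝ] Euc n := B.constr ℝ fun i => ζ i.succ - ζ 0
  let F : Euc n →L[ℝ] Euc n := LinearMap.toContinuousLinearMap F0
  have hF : ∀ i, F (w i - w 0) = ζ i - ζ 0 := by
    intro i
    refine Fin.cases (by simp) (fun i => ?_) i
    have h1 : w i.succ - w 0 = B i := by simp [B]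
    rw [h1]
    simp [F, F0, B.constr_basis]
  have hsub : ∀ i j, |⟪ζ i - ζ 0, ζ j - ζ 0⟫ - ⟪w i - w 0, w j - w 0⟫| ≤ (3 * R + 2) * ε := by
    intro i j
    apply polar_est R ε hε hε1 _ _ _ _ (hw _ _) (hw _ _) (by simpa using hw i j) (hζ _ _) (hζ _ _)
    simpa using hζ i j
  have hM1 : ∀ j, ‖ContinuousLinearMap.adjoint F (F (w j - w 0)) - (w j - w 0)‖
      ≤ K * ((3 * R + 2) * ε) := by
    intro j
    apply H
    intro i
    rw [inner_sub_right, ContinuousLinearMap.adjoint_inner_right, hF, hF]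
    exact hsub i j
  have hM : ∀ x, ‖ContinuousLinearMap.adjoint F (F x) - x‖
      ≤ K * (K * ((3 * R + 2) * ε)) * ‖x‖ := by
    intro x
    rw [mul_assoc]
    apply H
    intro i
    have : ⟪w i - w 0, ContinuousLinearMap.adjoint F (F x) - x⟫
        = ⟪ContinuousLinearMap.adjoint F (F (w i - w 0)) - (w i - w 0), x⟫ := by
      rw [inner_sub_right, inner_sub_left _ (w i - w 0), ContinuousLinearMap.adjoint_inner_right,
        ContinuousLinearMap.adjoint_inner_left]
    rw [this]
    refine (abs_real_inner_le_norm _ _).trans ?_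
    exact mul_le_mul_of_nonneg_right (hM1 i) (norm_nonneg _)
  obtain ⟨Q, hQ⟩ := exists_isometry_near F _ hε2 hM
  refine ⟨Q, fun w' ζ' hw' hζ' => ?_⟩
  obtain ⟨u, hu⟩ := Q.surjective (ζ' - ζ 0 - Q (w' - w 0))
  rw [← hu, Q.norm_map, mul_assoc]
  apply H
  intro i
  have e1 : ⟪w i - w 0, u⟫ = (⟪ζ i - ζ 0, ζ' - ζ 0⟫ - ⟪w i - w 0, w' - w 0⟫)
      - ⟪(ζ i - ζ 0) - Q (w i - w 0), ζ' - ζ 0⟫ := by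
    rw [← Q.inner_map_map, hu, inner_sub_right, Q.inner_map_map, inner_sub_left (ζ i - ζ 0) (Q (w i - w 0))]
    ring
  have e2 : |⟪ζ i - ζ 0, ζ' - ζ 0⟫ - ⟪w i - w 0, w' - w 0⟫| ≤ (3 * R + 2) * ε := by
    apply polar_est R ε hε hε1 _ _ _ _ (hw _ _) (by simpa [norm_sub_rev] using hw' 0)
      (by simpa using hw' i) (hζ _ _) (by simpa [norm_sub_rev] using hζ' 0)
    simpa using hζ' i
  have e3 : ‖(ζ i - ζ 0) - Q (w i - w 0)‖ ≤ n * (K * (K * ((3 * R + 2) * ε))) * R := by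
    rw [← hF]
    exact (hQ _).trans (mul_le_mul_of_nonneg_left (hw _ _) (by positivity))
  have e4 : ‖ζ' - ζ 0‖ ≤ R + 1 := by
    have := (abs_le.1 (hζ' 0)).2
    rw [norm_sub_rev]
    linarith [hw' 0]
  have e5 : |⟪(ζ i - ζ 0) - Q (w i - w 0), ζ' - ζ 0⟫|
      ≤ (n * (K * (K * ((3 * R + 2) * ε))) * R) * (R + 1) :=
    (abs_real_inner_le_norm _ _).trans (mul_le_mul e3 e4 (norm_nonneg _) (by positivity))
  rw [e1]
  refine (abs_sub _ _).trans ((add_le_add e2 e5).trans (le_of_eq ?_))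
  ring

lemma core {n : ℕ} (K R : ℝ) (hK : 0 < K) (hR : 0 < R) :
    ∃ C : ℝ, 0 < C ∧ ∀ ε : ℝ, 0 < ε → ∀ w ζ : Fin (n+1) → Euc n,
    (∀ (u : Euc n) (δ : ℝ), (∀ i, |⟪w i - w 0, u⟫| ≤ δ) → ‖u‖ ≤ K * δ) →
    (∀ i j, ‖w i - w j‖ ≤ R) →
    (∀ i j, |‖ζ i - ζ j‖ - ‖w i - w j‖| ≤ ε) →
    ∃ Q : Euc n ≃ₗᵢ[ℝ] Euc n, ∀ w' ζ' : Euc n, (∀ i, ‖w i - w'‖ ≤ R) →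
      (∀ i, |‖ζ i - ζ'‖ - ‖w i - w'‖| ≤ ε) →
      ‖ζ' - ζ 0 - Q (w' - w 0)‖ ≤ C * ε := by
  obtain ⟨e0, h0, h01, h02⟩ : ∃ e0 : ℝ, 0 < e0 ∧ e0 ≤ 1 ∧ K * (K * ((3 * R + 2) * e0)) ≤ 1 / 2 := by
    refine ⟨min 1 (1 / (2 * (K * (K * (3 * R + 2))))), by positivity, min_le_left _ _, ?_⟩
    have := min_le_right 1 (1 / (2 * (K * (K * (3 * R + 2)))))
    calc _ = (K * (K * (3 * R + 2))) * min 1 (1 / (2 * (K * (K * (3 * R + 2))))) := by ring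
      _ ≤ (K * (K * (3 * R + 2))) * (1 / (2 * (K * (K * (3 * R + 2))))) :=
        mul_le_mul_of_nonneg_left this (by positivity)
      _ = 1 / 2 := by field_simp
  let C1 := K * ((3 * R + 2) + (n * (K * (K * (3 * R + 2))) * R) * (R + 1))
  have hC1 : 0 < C1 := by positivity
  refine ⟨C1 + (2 * R / e0 + 1), by positivity, fun ε hε w ζ H hw hζ => ?_⟩
  by_cases hle : ε ≤ e0
  · obtain ⟨Q, hQ⟩ := core_small K R hK hR ε hε (hle.trans h01)
      (le_trans (by gcongr) h02) w ζ H hw hζ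
    refine ⟨Q, fun w' ζ' h1 h2 => (hQ w' ζ' h1 h2).trans ?_⟩
    apply mul_le_mul_of_nonneg_right _ hε.le
    have : 0 < 2 * R / e0 + 1 := by positivity
    change C1 ≤ _
    linarith
  · refine ⟨LinearIsometryEquiv.refl ℝ _, fun w' ζ' h1 h2 => ?_⟩
    have a1 := (abs_le.1 (h2 0)).2
    have a2 := h1 0
    rw [norm_sub_rev] at a1
    have a3 : ‖ζ' - ζ 0 - (w' - w 0)‖ ≤ 2 * R + ε := by
      refine (norm_sub_le _ _).trans ?_
      rw [norm_sub_rev w']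
      linarith
    refine a3.trans ?_
    have a4 : 2 * R ≤ 2 * R / e0 * ε := by
      rw [div_mul_eq_mul_div, le_div_iff₀ h0]
      push Not at hle
      nlinarith
    nlinarith [mul_pos hC1 hε]

/-- A fat simplex controls vectors through inner products with its edges. -/
lemma fat_control {n : ℕ} (b : ℝ) (hb : 0 < b) (z : Fin (n+1) → Euc n) (y : Euc n)
    (hy : ball y b ⊆ convexHull ℝ (Set.range z)) (u : Euc n) (δ : ℝ)
    (h : ∀ i, |⟪z i - z 0, u⟫| ≤ δ) : ‖u‖ ≤ 2 / b * δ := by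
  have hconv : ∀ x ∈ ball y b, |⟪x - z 0, u⟫| ≤ δ := by
    intro x hx
    have hc : Convex ℝ {x : Euc n | |⟪x - z 0, u⟫| ≤ δ} := by
      intro p hp q hq s t hs ht hst
      simp only [Set.mem_ofPred_eq] at *
      have : s • p + t • q - z 0 = s • (p - z 0) + t • (q - z 0) := by
        have h1 : z 0 = s • z 0 + t • z 0 := by rw [← add_smul, hst, one_smul]
        conv_lhs => rw [h1]
        rw [smul_sub, smul_sub]; abel
      rw [this, inner_add_left, inner_smul_left, inner_smul_left]
      simp only [conj_trivial]
      rw [abs_le] at *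
      have ht1 : t = 1 - s := by linarith
      constructor <;> nlinarith
    exact convexHull_min (by rintro _ ⟨i, rfl⟩; exact h i) hc (hy hx)
  by_cases hu : u = 0
  · subst hu
    have := h 0
    have : 0 ≤ δ := (abs_nonneg _).trans this
    simp; positivity
  have hun : 0 < ‖u‖ := norm_pos_iff.2 hu
  have h1 := hconv y (mem_ball_self hb)
  have h2 := hconv (y + (b / 2 / ‖u‖) • u) (by
    rw [mem_ball, dist_eq_norm, add_sub_cancel_left, norm_smul, Real.norm_eq_abs,
      abs_of_pos (by positivity), div_mul_cancel₀ _ hun.ne']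
    linarith)
  have h3 := hconv (y - (b / 2 / ‖u‖) • u) (by
    rw [mem_ball, dist_eq_norm, sub_sub_cancel_left, norm_neg, norm_smul, Real.norm_eq_abs,
      abs_of_pos (by positivity), div_mul_cancel₀ _ hun.ne']
    linarith)
  have e1 : ⟪(b / 2 / ‖u‖) • u, u⟫ = b / 2 * ‖u‖ := by
    rw [inner_smul_left, real_inner_self_eq_norm_mul_norm]
    simp only [conj_trivial]
    field_simp
  rw [add_sub_right_comm, inner_add_left, e1] at h2
  rw [sub_right_comm, inner_sub_left, e1] at h3
  have h2 := (abs_le.1 h2).2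
  have h3 := (abs_le.1 h3).1
  rw [div_mul_eq_mul_div, le_div_iff₀ hb]
  nlinarith

lemma vnorm_eq {n : ℕ} (v : Fin n → ℝ) : vnorm v = ‖toEuc v‖ := by
  simp [vnorm, toEuc, EuclideanSpace.norm_eq]

/-- **A linear algebra lemma** (Lemma `L12`): near-isometry on the vertices of a fat
simplex is close to an affine map with gradient in `O(n)A`. -/
theorem near_isometry_affine_approximation
    (n : ℕ) (hn : 2 ≤ n) (A : Mat n) (hA : A.det ≠ 0) (b : ℝ) (hb : 0 < b) :
    ∃ C : ℝ, 0 < C ∧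
      ∀ ε : ℝ, 0 < ε →
      ∀ z ζ : Fin (n+1) → Euc n,
        (∀ i, z i ∈ ball (0 : Euc n) 1) →
        (∃ y ∈ ball (0 : Euc n) 1, ball y b ⊆ convexHull ℝ (Set.range z)) →
        (∀ i j, i ≠ j → |‖ζ i - ζ j‖ - vnorm (A.mulVec (ofEuc (z i - z j)))| ≤ ε) →
        ∃ O ∈ (fun Q => Q * A) '' On n, ∃ c : Euc n,
          (∀ i, ‖ζ i - (toEuc (O.mulVec (ofEuc (z i))) + c)‖ ≤ C * ε) ∧
          ∀ z' ζ' : Euc n, z' ∈ ball (0 : Euc n) 1 →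
            (∀ i, |‖ζ i - ζ'‖ - vnorm (A.mulVec (ofEuc (z i - z')))| ≤ ε) →
            ‖ζ' - (toEuc (O.mulVec (ofEuc z')) + c)‖ ≤ C * ε := by
  classical
  let T : Euc n →L[ℝ] Euc n := LinearMap.toContinuousLinearMap (Matrix.toLpLin 2 2 A)
  let S : Euc n →L[ℝ] Euc n := LinearMap.toContinuousLinearMap (Matrix.toLpLin 2 2 A⁻¹)
  have hT : ∀ x, T x = toEuc (A.mulVec (ofEuc x)) := fun x => by
    simp [T, toEuc, ofEuc, Matrix.toLpLin_apply]
  have hTS : T ∘L S = 1 := by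
    ext x : 1
    simp [T, S, Matrix.toLpLin_apply, Matrix.mulVec_mulVec, Matrix.mul_nonsing_inv A (isUnit_iff_ne_zero.2 hA)]
  have hadj : ∀ u, ContinuousLinearMap.adjoint S (ContinuousLinearMap.adjoint T u) = u := by
    intro u
    refine ext_inner_right ℝ fun x => ?_
    rw [ContinuousLinearMap.adjoint_inner_left, ContinuousLinearMap.adjoint_inner_left]
    have h2 := congrArg (fun L : Euc n →L[ℝ] Euc n => L x) hTS
    have h3 : T (S x) = x := h2
    rw [h3]
  let N := ‖ContinuousLinearMap.adjoint S‖ + 1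
  have hN : 0 < N := by positivity
  let R := ‖T‖ * 2 + 1
  have hR : 0 < R := by positivity
  obtain ⟨C, hC, hmain⟩ := core (n := n) (N * (2 / b)) R (by positivity) hR
  refine ⟨C, hC, fun ε hε z ζ hz ⟨y, _, hy⟩ hζ => ?_⟩
  have hbd : ∀ p q : Euc n, p ∈ ball (0 : Euc n) 1 → q ∈ ball (0 : Euc n) 1 → ‖T p - T q‖ ≤ R := by
    intro p q hp hq
    rw [mem_ball_zero_iff] at hp hq
    rw [← map_sub]
    refine (T.le_opNorm _).trans ?_
    have : ‖p - q‖ ≤ 2 := (norm_sub_le _ _).trans (by linarith)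
    have := mul_le_mul_of_nonneg_left this (norm_nonneg T)
    linarith
  have hv : ∀ p q : Euc n, vnorm (A.mulVec (ofEuc (p - q))) = ‖T p - T q‖ := by
    intro p q
    rw [vnorm_eq, ← hT, map_sub]
  simp only [hv] at hζ
  simp only [hv]
  have hζ' : ∀ i j, |‖ζ i - ζ j‖ - ‖T (z i) - T (z j)‖| ≤ ε := by
    intro i j
    by_cases hij : i = j
    · subst hij; simp [hε.le]
    · exact hζ i j hij
  obtain ⟨Q, hQ⟩ := hmain ε hε (fun i => T (z i)) ζ (by
    intro u δ h
    have h1 : ‖ContinuousLinearMap.adjoint T u‖ ≤ 2 / b * δ := by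
      apply fat_control b hb z y hy
      intro i
      rw [ContinuousLinearMap.adjoint_inner_right, map_sub]
      exact h i
    have h2 := (ContinuousLinearMap.adjoint S).le_opNorm (ContinuousLinearMap.adjoint T u)
    rw [hadj] at h2
    have h3 : ‖u‖ ≤ N * ‖ContinuousLinearMap.adjoint T u‖ := by
      refine h2.trans (mul_le_mul_of_nonneg_right ?_ (norm_nonneg _))
      simp [N]
    rw [mul_assoc]
    exact h3.trans (mul_le_mul_of_nonneg_left h1 hN.le))
    (fun i j => hbd _ _ (hz i) (hz j)) hζ'
  let q : Mat n := (Matrix.toLpLin 2 2).symm (Q.toLinearEquiv : Euc n →ₗ[ℝ] Euc n)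
  have hq : ∀ x : Euc n, toEuc (q.mulVec (ofEuc x)) = Q x := by
    intro x
    have : Matrix.toLpLin 2 2 q x = Q x := by simp [q]
    rw [← this]
    simp [toEuc, ofEuc, Matrix.toLpLin_apply]
  have hqo : q ∈ On n := by
    change qᵀ * q = 1
    ext i j
    have h := Q.inner_map_map (EuclideanSpace.single i (1:ℝ)) (EuclideanSpace.single j (1:ℝ))
    rw [← hq, ← hq] at h
    simp [toEuc, ofEuc, PiLp.inner_apply, Matrix.mulVec_single] at h
    rw [Matrix.mul_apply, Matrix.one_apply]
    simp only [Matrix.transpose_apply]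
    rw [← h]
    exact Finset.sum_congr rfl fun k _ => mul_comm _ _
  have hO : ∀ x : Euc n, toEuc ((q * A).mulVec (ofEuc x)) = Q (T x) := by
    intro x
    rw [← hq, hT, ← Matrix.mulVec_mulVec]
    rfl
  have hfin : ∀ z' ζ' : Euc n, z' ∈ ball (0 : Euc n) 1 →
      (∀ i, |‖ζ i - ζ'‖ - ‖T (z i) - T z'‖| ≤ ε) →
      ‖ζ' - (toEuc ((q * A).mulVec (ofEuc z')) + (ζ 0 - Q (T (z 0))))‖ ≤ C * ε := by
    intro z' ζ' h1 h2
    have := hQ (T z') ζ' (fun i => hbd _ _ (hz i) h1) h2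
    rw [hO]
    convert this using 2
    rw [map_sub]; abel
  exact ⟨q * A, ⟨q, hqo, rfl⟩, ζ 0 - Q (T (z 0)),
    fun i => hfin _ _ (hz i) (fun j => hζ' j i), hfin⟩
end
end
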